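/- Let u be a classical solution of the boundary reaction problem such that u(t,0) → L⁺ as t → +∞ and u(t,0) → L⁻ as t → −∞ for some constants L⁻, L⁺ (possibly equal). Then for every fixed T > 0, sup{ |∂_t u(s,y)| : (s−b)² + y² ≤ T², y ≥ 0 } → 0 as b → +∞, and likewise as b → −∞. -/

import Mathlib

open Real Filter MeasureTheory Set Topology

noncomputable def pt (u : ℝ → ℝ → ℝ) (t y : ℝ) : ℝ := deriv (fun s => u s y) t
noncomputable def py (u : ℝ → ℝ → ℝ) (t y : ℝ) : ℝ := deriv (fun z => u t z) y
noncomputable def ptt (u : ℝ → ℝ → ℝ) (t y : ℝ) : ℝ := deriv (fun s => pt u s y) t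
noncomputable def pyy (u : ℝ → ℝ → ℝ) (t y : ℝ) : ℝ := deriv (fun z => py u t z) y
noncomputable def pty (u : ℝ → ℝ → ℝ) (t y : ℝ) : ℝ := deriv (fun z => pt u t z) y

/-- The degenerate elliptic operator `H_a u = u_yy + (a/y) u_y + u_tt + (n-1) tanh t · u_t`. -/
noncomputable def Ha (n : ℕ) (a : ℝ) (u : ℝ → ℝ → ℝ) (t y : ℝ) : ℝ :=
  pyy u t y + (a / y) * py u t y + ptt u t y + ((n : ℝ) - 1) * Real.tanh t * pt u t y

/-- A classical solution of the boundary reaction problem: a bounded continuous function on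
`ℝ × [0,∞)`, `C²` on `ℝ × (0,∞)`, with `H_a u = 0` there, `∂_t u` extending continuously to
`ℝ × [0,∞)`, and for every `t` the limit `lim_{y→0⁺} y^a ∂_y u(t,y)` exists and equals
`-f(u(t,0)) = F'(u(t,0))`, where `f = -F'`. -/
structure BRSolution (n : ℕ) (a : ℝ) (F : ℝ → ℝ) (u : ℝ → ℝ → ℝ) : Prop where
  bounded : ∃ M : ℝ, ∀ t y : ℝ, 0 ≤ y → |u t y| ≤ M
  cont : ContinuousOn (fun p : ℝ × ℝ => u p.1 p.2) {p : ℝ × ℝ | 0 ≤ p.2}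
  smooth : ContDiffOn ℝ 2 (fun p : ℝ × ℝ => u p.1 p.2) {p : ℝ × ℝ | 0 < p.2}
  eqn : ∀ t y : ℝ, 0 < y → Ha n a u t y = 0
  pt_cont : ContinuousOn (fun p : ℝ × ℝ => pt u p.1 p.2) {p : ℝ × ℝ | 0 ≤ p.2}
  bc : ∀ t : ℝ, Tendsto (fun y : ℝ => y ^ a * py u t y) (𝓝[>] (0:ℝ))
        (𝓝 (deriv F (u t 0)))

/-- `F` is a smooth double-well potential: `F(±1) = 0`, `F > 0` on `(-1,1)`,
`F'(±1) = 0`, `F''(±1) > 0`. -/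
def DoubleWell (F : ℝ → ℝ) : Prop :=
  ContDiff ℝ (⊤ : ℕ∞) F ∧ F (-1) = 0 ∧ F 1 = 0 ∧ (∀ s ∈ Set.Ioo (-1:ℝ) 1, 0 < F s) ∧
    deriv F (-1) = 0 ∧ deriv F 1 = 0 ∧
    0 < iteratedDeriv 2 F (-1) ∧ 0 < iteratedDeriv 2 F 1

/-- A function vanishing at `0` which is, for large `D`, a strict supersolution of one-dimensional
equations with drift at most `c`. -/
noncomputable def expBarrier (c D s : ℝ) : ℝ :=
  exp (2 * c + 2) * D * (1 - exp (-((2 * c + 2) * s)))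

/-- The derivative of `expBarrier`. -/
noncomputable def expBarrier' (c D s : ℝ) : ℝ :=
  exp (2 * c + 2) * D * ((2 * c + 2) * exp (-((2 * c + 2) * s)))

theorem hasDerivAt_expBarrier (c D s : ℝ) :
    HasDerivAt (expBarrier c D) (expBarrier' c D s) s := by
  have h := ((((hasDerivAt_id s).const_mul (2 * c + 2)).neg.exp).const_sub 1).const_mul
    (exp (2 * c + 2) * D)
  refine h.congr_deriv ?_
  simp only [expBarrier', id, Pi.neg_apply]; ring

theorem hasDerivAt_expBarrier' (c D s : ℝ) :
    HasDerivAt (expBarrier' c D) (-((2 * c + 2) * expBarrier' c D s)) s := by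
  have h := ((((hasDerivAt_id s).const_mul (2 * c + 2)).neg.exp).const_mul (2 * c + 2)).const_mul
    (exp (2 * c + 2) * D)
  refine h.congr_deriv ?_
  simp only [expBarrier', id, Pi.neg_apply]; ring

theorem continuous_expBarrier (c D : ℝ) : Continuous (expBarrier c D) := by
  unfold expBarrier; fun_prop

theorem expBarrier_le {c D s : ℝ} (hD : 0 ≤ D) :
    expBarrier c D s ≤ exp (2 * c + 2) * D * ((2 * c + 2) * s) := by
  unfold expBarrier
  have := Real.add_one_le_exp (-((2 * c + 2) * s))
  exact mul_le_mul_of_nonneg_left (by linarith) (by positivity)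

theorem mul_le_expBarrier' {c D s : ℝ} (hc : 0 ≤ c) (hD : 0 ≤ D) (hs : s ≤ 1) :
    D * (2 * c + 2) ≤ expBarrier' c D s := by
  unfold expBarrier'
  have h : 1 ≤ exp (2 * c + 2) * exp (-((2 * c + 2) * s)) := by
    rw [← Real.exp_add]
    exact Real.one_le_exp (by nlinarith)
  have := mul_le_mul_of_nonneg_left h (show 0 ≤ D * (2 * c + 2) by positivity)
  linarith

theorem self_le_expBarrier {c D s : ℝ} (hc : 0 ≤ c) (hD : 1 ≤ D) (hs0 : 0 ≤ s) (hs : s ≤ 1) :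
    s ≤ expBarrier c D s := by
  have h1 := mul_le_expBarrier' hc (by linarith : 0 ≤ D) hs
  have h2 : expBarrier' c D s * s ≤ expBarrier c D s := by
    unfold expBarrier expBarrier'
    have h3 := Real.add_one_le_exp ((2 * c + 2) * s)
    have h4 : exp ((2 * c + 2) * s) * exp (-((2 * c + 2) * s)) = 1 := by
      rw [← Real.exp_add]; simp
    have h5 := mul_le_mul_of_nonneg_right h3 (Real.exp_pos (-((2 * c + 2) * s))).le
    rw [mul_assoc]
    exact mul_le_mul_of_nonneg_left (by linarith) (by positivity)
  have h6 : 1 ≤ D * (2 * c + 2) := by nlinarith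
  nlinarith

theorem expBarrier_strict {c D s β γ τ : ℝ} (hc : 0 ≤ c) (hD : 1 + 2 * c < D) (hs : s ≤ 1)
    (hβ : |β| ≤ 1) (hγ : |γ| ≤ 1) (hτ : |τ| ≤ 1) :
    D + (2 + -((2 * c + 2) * expBarrier' c D s)) / 2 +
      c * (β * expBarrier' c D s + γ * (2 * τ)) < 0 := by
  have h1 := mul_le_expBarrier' hc (by linarith : 0 ≤ D) hs
  set q := expBarrier' c D s
  have hq : 0 ≤ q := le_trans (by positivity [show 0 ≤ D by linarith]) h1
  have h2 : β * q ≤ q := mul_le_of_le_one_left hq (abs_le.mp hβ).2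
  have h3 : γ * τ ≤ 1 := by
    refine (le_abs_self _).trans ?_
    rw [abs_mul]
    exact mul_le_one₀ hγ (abs_nonneg _) hτ
  have h4 : c * (β * q + γ * (2 * τ)) ≤ c * (q + 2) :=
    mul_le_mul_of_nonneg_left (by linarith) hc
  nlinarith

/-- A function with positive weighted derivative at the left endpoint has no maximum there. -/
theorem not_forall_le_of_tendsto_rpow_mul_deriv {a h l : ℝ} {f f' : ℝ → ℝ} (hh : 0 < h)
    (hc : ContinuousOn f (Icc 0 h)) (hd : ∀ y, 0 < y → HasDerivAt f (f' y) y)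
    (hl : Tendsto (fun y => y ^ a * f' y) (𝓝[>] 0) (𝓝 l)) (hl0 : 0 < l) :
    ¬ ∀ y ∈ Icc 0 h, f y ≤ f 0 := by
  intro hmax
  obtain ⟨d, hd0, hdpos⟩ := mem_nhdsGT_iff_exists_Ioo_subset.mp (hl.eventually_const_lt hl0)
  have he : 0 < min d h := lt_min hd0 hh
  have hmono : StrictMonoOn f (Icc 0 (min d h)) := by
    refine strictMonoOn_of_deriv_pos (convex_Icc _ _)
      (hc.mono (Icc_subset_Icc_right (min_le_right _ _))) fun y hy => ?_
    rw [interior_Icc] at hy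
    rw [(hd y hy.1).deriv]
    have : 0 < y ^ a * f' y := hdpos ⟨hy.1, hy.2.trans_le (min_le_left _ _)⟩
    exact pos_of_mul_pos_right this (Real.rpow_nonneg hy.1.le _)
  have := hmono ⟨le_rfl, he.le⟩ ⟨he.le, le_rfl⟩ he
  exact absurd (hmax _ ⟨he.le, min_le_right _ _⟩) (not_le.mpr this)

theorem IsLocalMax.deriv_eq_zero_and_nonpos {f f' : ℝ → ℝ} {x c : ℝ} (h : IsLocalMax f x)
    (hf : ∀ᶠ z in 𝓝 x, HasDerivAt f (f' z) z) (hf' : HasDerivAt f' c x) :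
    f' x = 0 ∧ c ≤ 0 := by
  have h0 : f' x = 0 := h.hasDerivAt_eq_zero hf.self_of_nhds
  refine ⟨h0, ?_⟩
  by_contra! hc
  have hd : deriv f =ᶠ[𝓝 x] f' := hf.mono fun z hz => hz.deriv
  have hdd : deriv (deriv f) x = c := by rw [hd.deriv_eq, hf'.deriv]
  have hmin : IsLocalMin f x :=
    isLocalMin_of_deriv_deriv_pos (by rw [hdd]; exact hc) (by rw [hd.self_of_nhds, h0])
      hf.self_of_nhds.continuousAt
  have hconst : f =ᶠ[𝓝 x] fun _ => f x := by
    filter_upwards [h, hmin] with z h1 h2 using le_antisymm h1 h2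
  have hd0 : deriv f =ᶠ[𝓝 x] fun _ => 0 := by
    filter_upwards [hconst.eventuallyEq_nhds] with z hz
    rw [hz.deriv_eq, deriv_const]
  rw [hd0.deriv_eq, deriv_const] at hdd
  linarith

namespace BRSolution

variable {n : ℕ} {a : ℝ} {F : ℝ → ℝ} {u : ℝ → ℝ → ℝ}

theorem contDiffAt (hu : BRSolution n a F u) (t : ℝ) {y : ℝ} (hy : 0 < y) :
    ContDiffAt ℝ 2 (fun p : ℝ × ℝ => u p.1 p.2) (t, y) :=
  hu.smooth.contDiffAt ((isOpen_lt continuous_const continuous_snd).mem_nhds hy)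

theorem contDiffAt_left (hu : BRSolution n a F u) (t : ℝ) {y : ℝ} (hy : 0 < y) :
    ContDiffAt ℝ 2 (fun r => u r y) t :=
  (hu.contDiffAt t hy).comp t (f := fun r : ℝ => (r, y)) (contDiffAt_id.prodMk contDiffAt_const)

theorem contDiffAt_right (hu : BRSolution n a F u) (t : ℝ) {y : ℝ} (hy : 0 < y) :
    ContDiffAt ℝ 2 (fun z => u t z) y :=
  (hu.contDiffAt t hy).comp y (f := fun z : ℝ => (t, z)) (contDiffAt_const.prodMk contDiffAt_id)

theorem hasDerivAt_pt (hu : BRSolution n a F u) (t : ℝ) {y : ℝ} (hy : 0 < y) :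
    HasDerivAt (fun r => u r y) (pt u t y) t :=
  ((hu.contDiffAt_left t hy).differentiableAt (by norm_num)).hasDerivAt

theorem hasDerivAt_py (hu : BRSolution n a F u) (t : ℝ) {y : ℝ} (hy : 0 < y) :
    HasDerivAt (fun z => u t z) (py u t y) y :=
  ((hu.contDiffAt_right t hy).differentiableAt (by norm_num)).hasDerivAt

theorem hasDerivAt_ptt (hu : BRSolution n a F u) (t : ℝ) {y : ℝ} (hy : 0 < y) :
    HasDerivAt (fun r => pt u r y) (ptt u t y) t :=
  (((hu.contDiffAt_left t hy).derivWithin (m := 1) (by norm_num)).differentiableAt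
    (by norm_num)).hasDerivAt

theorem hasDerivAt_pyy (hu : BRSolution n a F u) (t : ℝ) {y : ℝ} (hy : 0 < y) :
    HasDerivAt (fun z => py u t z) (pyy u t y) y :=
  (((hu.contDiffAt_right t hy).derivWithin (m := 1) (by norm_num)).differentiableAt
    (by norm_num)).hasDerivAt

/-- If a function of the two variables separately touches `σ u` from above at an interior point,
it is a subsolution there. -/
theorem touch (hu : BRSolution n a F u) (σ : ℝ) {t y : ℝ} (hy : 0 < y)
    {ft ft' fy fy' : ℝ → ℝ} {ft2 fy2 : ℝ}
    (mt : IsLocalMax (fun r => σ * u r y - ft r) t)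
    (my : IsLocalMax (fun z => σ * u t z - fy z) y)
    (ht : ∀ r, HasDerivAt ft (ft' r) r) (ht2 : HasDerivAt ft' ft2 t)
    (hfy : ∀ z, 0 < z → HasDerivAt fy (fy' z) z) (hy2 : HasDerivAt fy' fy2 y) :
    0 ≤ fy2 + a / y * fy' y + ft2 + ((n : ℝ) - 1) * Real.tanh t * ft' t := by
  obtain ⟨h1, h2⟩ := mt.deriv_eq_zero_and_nonpos
    (Eventually.of_forall fun r => ((hu.hasDerivAt_pt r hy).const_mul σ).sub (ht r))
    (((hu.hasDerivAt_ptt t hy).const_mul σ).sub ht2)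
  obtain ⟨h3, h4⟩ := my.deriv_eq_zero_and_nonpos
    ((lt_mem_nhds hy).mono fun z hz => ((hu.hasDerivAt_py t hz).const_mul σ).sub (hfy z hz))
    (((hu.hasDerivAt_pyy t hy).const_mul σ).sub hy2)
  have e := hu.eqn t y hy
  unfold Ha at e
  rw [← sub_eq_zero.mp h1, ← sub_eq_zero.mp h3]
  have : σ * (pyy u t y + a / y * py u t y + ptt u t y
    + ((n : ℝ) - 1) * Real.tanh t * pt u t y) = 0 := by rw [e, mul_zero]
  linarith

/-- If a function touches `σ (u (t + s) y - u (t - s) y)` from above along each of the three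
coordinate lines through an interior point, it is a subsolution of the doubled equation there. -/
theorem touch_symmDiff (hu : BRSolution n a F u) (σ : ℝ) {t s y : ℝ} (hy : 0 < y)
    {ft ft' fs fs' fy fy' : ℝ → ℝ} {ft2 fs2 fy2 : ℝ}
    (mt : IsLocalMax (fun r => σ * (u (r + s) y - u (r - s) y) - ft r) t)
    (ms : IsLocalMax (fun r => σ * (u (t + r) y - u (t - r) y) - fs r) s)
    (my : IsLocalMax (fun z => σ * (u (t + s) z - u (t - s) z) - fy z) y)
    (ht : ∀ r, HasDerivAt ft (ft' r) r) (ht2 : HasDerivAt ft' ft2 t)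
    (hs : ∀ r, HasDerivAt fs (fs' r) r) (hs2 : HasDerivAt fs' fs2 s)
    (hfy : ∀ z, 0 < z → HasDerivAt fy (fy' z) z) (hy2 : HasDerivAt fy' fy2 y) :
    ∃ β γ : ℝ, |β| ≤ 1 ∧ |γ| ≤ 1 ∧
      0 ≤ fy2 + a / y * fy' y + (ft2 + fs2) / 2 + ((n : ℝ) - 1) * (β * fs' s + γ * ft' t) := by
  obtain ⟨h1, h2⟩ := mt.deriv_eq_zero_and_nonpos
    (Eventually.of_forall fun r =>
      ((((hu.hasDerivAt_pt (r + s) hy).comp_add_const r s).sub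
        ((hu.hasDerivAt_pt (r - s) hy).comp_sub_const r s)).const_mul σ).sub (ht r))
    (((((hu.hasDerivAt_ptt (t + s) hy).comp_add_const t s).sub
        ((hu.hasDerivAt_ptt (t - s) hy).comp_sub_const t s)).const_mul σ).sub ht2)
  obtain ⟨h3, h4⟩ := ms.deriv_eq_zero_and_nonpos
    (Eventually.of_forall fun r =>
      ((((hu.hasDerivAt_pt (t + r) hy).comp_const_add t r).sub
        ((hu.hasDerivAt_pt (t - r) hy).comp_const_sub t r)).const_mul σ).sub (hs r))
    (((((hu.hasDerivAt_ptt (t + s) hy).comp_const_add t s).sub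
        ((hu.hasDerivAt_ptt (t - s) hy).comp_const_sub t s).neg).const_mul σ).sub hs2)
  obtain ⟨h5, h6⟩ := my.deriv_eq_zero_and_nonpos
    ((lt_mem_nhds hy).mono fun z hz =>
      (((hu.hasDerivAt_py (t + s) hz).sub (hu.hasDerivAt_py (t - s) hz)).const_mul σ).sub
        (hfy z hz))
    ((((hu.hasDerivAt_pyy (t + s) hy).sub (hu.hasDerivAt_pyy (t - s) hy)).const_mul σ).sub hy2)
  have e1 := hu.eqn (t + s) y hy
  have e2 := hu.eqn (t - s) y hy
  have b1 := abs_le.mp (Real.abs_tanh_lt_one (t + s)).le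
  have b2 := abs_le.mp (Real.abs_tanh_lt_one (t - s)).le
  refine ⟨(Real.tanh (t + s) - Real.tanh (t - s)) / 2,
    (Real.tanh (t + s) + Real.tanh (t - s)) / 2, ?_, ?_, ?_⟩
  · rw [abs_le]; constructor <;> linarith
  · rw [abs_le]; constructor <;> linarith
  · unfold Ha at e1 e2
    rw [← sub_eq_zero.mp h1, ← sub_eq_zero.mp h3, ← sub_eq_zero.mp h5]
    have : σ * ((pyy u (t + s) y + a / y * py u (t + s) y + ptt u (t + s) y
        + ((n : ℝ) - 1) * Real.tanh (t + s) * pt u (t + s) y)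
      - (pyy u (t - s) y + a / y * py u (t - s) y + ptt u (t - s) y
        + ((n : ℝ) - 1) * Real.tanh (t - s) * pt u (t - s) y)) = 0 := by
      rw [e1, e2, sub_zero, mul_zero]
    linarith

/-- Barrier estimate on a long rectangle for the distance of `u` to a constant. -/
theorem mul_sub_le_barrier (hu : BRSolution n a F u) (ha : a ∈ Ioo (-1 : ℝ) 1) (hn : 1 ≤ n)
    {σ L M δ E₁ E₂ H R b β : ℝ} (hσ : |σ| ≤ 1) (hM : ∀ t y, 0 ≤ y → |u t y - L| ≤ M)
    (hδ : 0 ≤ δ) (hE₁ : 0 ≤ E₁) (hE₂ : 0 ≤ E₂) (hR : 0 < R) (hβ : β = (1 - a) / 2)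
    (hH : 0 < H) (hHM : M ≤ E₁ * H ^ (1 - a))
    (hRM : M * (2 + 2 * ((n : ℝ) - 1) * R) / R ^ 2 < E₂ * β ^ 2 * H ^ (β - 2))
    (hb : ∀ t, |t - b| ≤ R → |u t 0 - L| ≤ δ) {y₀ : ℝ} (hy₀ : 0 ≤ y₀) (hy₀H : y₀ ≤ H) :
    σ * (u b y₀ - L) ≤ δ + E₁ * y₀ ^ (1 - a) + E₂ * y₀ ^ β := by
  have hσu : ∀ t y D, |u t y - L| ≤ D → σ * (u t y - L) ≤ D := fun t y D h => by
    refine (le_abs_self _).trans ?_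
    rw [abs_mul]
    exact (mul_le_of_le_one_left (abs_nonneg _) hσ).trans h
  have hM0 : 0 ≤ M := (abs_nonneg _).trans (hM 0 0 le_rfl)
  have hβ0 : 0 < β := by linarith [ha.2]
  have hc : (0 : ℝ) ≤ (n : ℝ) - 1 := by
    have : (1 : ℝ) ≤ n := by exact_mod_cast hn
    linarith
  let Φ : ℝ → ℝ → ℝ := fun t y => δ + E₁ * y ^ (1 - a) + M * (t - b) ^ 2 / R ^ 2 + E₂ * y ^ β
  by_contra! hcon
  let K : Set (ℝ × ℝ) := Icc (b - R) (b + R) ×ˢ Icc 0 H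
  have hK : IsCompact K := isCompact_Icc.prod isCompact_Icc
  have hcont : ContinuousOn (fun p : ℝ × ℝ => σ * u p.1 p.2 - Φ p.1 p.2) K := by
    refine (continuousOn_const.mul (hu.cont.mono fun p hp => hp.2.1)).sub
      (Continuous.continuousOn ?_)
    have h1 : Continuous fun p : ℝ × ℝ => p.2 ^ (1 - a) :=
      continuous_snd.rpow_const fun _ => Or.inr (by linarith [ha.2])
    have h2 : Continuous fun p : ℝ × ℝ => p.2 ^ β :=
      continuous_snd.rpow_const fun _ => Or.inr hβ0.le
    fun_prop
  have hbK : (b, y₀) ∈ K := ⟨⟨by simp [hR.le], by simp [hR.le]⟩, hy₀, hy₀H⟩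
  obtain ⟨⟨t, y⟩, ⟨⟨ht1, ht2⟩, hy1, hy2⟩, hmax⟩ := hK.exists_isMaxOn ⟨_, hbK⟩ hcont
  simp only at ht1 ht2 hy1 hy2
  have hpos : Φ t y < σ * (u t y - L) := by
    have h1 : σ * u b y₀ - Φ b y₀ ≤ σ * u t y - Φ t y := hmax hbK
    have h2 : Φ b y₀ = δ + E₁ * y₀ ^ (1 - a) + E₂ * y₀ ^ β := by simp [Φ]
    linarith
  have hp1 : 0 ≤ E₁ * y ^ (1 - a) := mul_nonneg hE₁ (Real.rpow_nonneg hy1 _)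
  have hp2 : 0 ≤ M * (t - b) ^ 2 / R ^ 2 := by positivity
  have hp3 : 0 ≤ E₂ * y ^ β := mul_nonneg hE₂ (Real.rpow_nonneg hy1 _)
  have hΦ : Φ t y = δ + E₁ * y ^ (1 - a) + M * (t - b) ^ 2 / R ^ 2 + E₂ * y ^ β := rfl
  have htR : |t - b| < R := by
    refine lt_of_le_of_ne (abs_le.mpr ⟨by linarith, by linarith⟩) fun h => ?_
    have h3 : M * (t - b) ^ 2 / R ^ 2 = M := by
      rw [← sq_abs, h]; field_simp
    linarith [hσu t y M (hM t y hy1)]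
  have hy0 : 0 < y := by
    refine lt_of_le_of_ne hy1 fun h => ?_
    subst h
    linarith [hσu t 0 δ (hb t htR.le)]
  have hyH : y < H := by
    refine lt_of_le_of_ne hy2 fun h => ?_
    subst h
    linarith [hσu t y M (hM t y hy1)]
  obtain ⟨ht3, ht4⟩ := abs_lt.mp htR
  have mt : IsLocalMax (fun r => σ * u r y - Φ r y) t := by
    filter_upwards [Icc_mem_nhds (show b - R < t by linarith) (show t < b + R by linarith)] with r hr
    exact hmax (show (r, y) ∈ K from ⟨hr, hy1, hy2⟩)
  have my : IsLocalMax (fun z => σ * u t z - Φ t z) y := by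
    filter_upwards [Icc_mem_nhds hy0 hyH] with z hz
    exact hmax (show (t, z) ∈ K from ⟨⟨ht1, ht2⟩, hz⟩)
  have key := hu.touch σ hy0 mt my
    (ft' := fun r => M * (2 * (r - b)) / R ^ 2) (ft2 := M * 2 / R ^ 2)
    (fy' := fun z => E₁ * ((1 - a) * z ^ (1 - a - 1)) + E₂ * (β * z ^ (β - 1)))
    (fy2 := E₁ * ((1 - a) * ((1 - a - 1) * y ^ (1 - a - 1 - 1))) +
      E₂ * (β * ((β - 1) * y ^ (β - 1 - 1))))
    (fun r => by
      have := (((((hasDerivAt_id r).sub_const b).pow 2).const_mul M).div_const (R ^ 2)).const_add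
        (δ + E₁ * y ^ (1 - a)) |>.add_const (E₂ * y ^ β)
      exact this.congr_deriv (by simp))
    (by
      have := ((((hasDerivAt_id t).sub_const b).const_mul 2).const_mul M).div_const (R ^ 2)
      exact this.congr_deriv (by simp))
    (fun z hz => by
      have := ((((Real.hasDerivAt_rpow_const (p := 1 - a) (Or.inl hz.ne')).const_mul
        E₁).const_add δ).add_const (M * (t - b) ^ 2 / R ^ 2)).add
        ((Real.hasDerivAt_rpow_const (p := β) (Or.inl hz.ne')).const_mul E₂)
      exact this)
    (((Real.hasDerivAt_rpow_const (Or.inl hy0.ne')).const_mul _).const_mul _ |>.add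
      (((Real.hasDerivAt_rpow_const (Or.inl hy0.ne')).const_mul _).const_mul _))
  have hP : y ^ (1 - a - 1) = y ^ (1 - a - 1 - 1) * y := by
    rw [← Real.rpow_add_one hy0.ne']; ring_nf
  have hQ : y ^ (β - 1) = y ^ (β - 2) * y := by
    rw [← Real.rpow_add_one hy0.ne']; ring_nf
  have hQ' : β - 1 - 1 = β - 2 := by ring
  have hyy : a / y * (E₁ * ((1 - a) * y ^ (1 - a - 1)) + E₂ * (β * y ^ (β - 1))) =
      a * (E₁ * ((1 - a) * y ^ (1 - a - 1 - 1)) + E₂ * (β * y ^ (β - 2))) := by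
    rw [hP, hQ]; field_simp
  simp only [hyy, hQ'] at key
  have hHy : H ^ (β - 2) ≤ y ^ (β - 2) :=
    Real.rpow_le_rpow_of_nonpos hy0 hyH.le (by linarith [ha.1])
  have hHy' : E₂ * β ^ 2 * H ^ (β - 2) ≤ E₂ * β ^ 2 * y ^ (β - 2) :=
    mul_le_mul_of_nonneg_left hHy (by positivity)
  have hdrift : Real.tanh t * (t - b) ≤ R := by
    refine (le_abs_self _).trans ?_
    rw [abs_mul]
    nlinarith [(Real.abs_tanh_lt_one t).le, abs_nonneg (t - b), abs_nonneg (Real.tanh t)]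
  have hfin : M * 2 / R ^ 2 + ((n : ℝ) - 1) * Real.tanh t * (M * (2 * (t - b)) / R ^ 2) ≤
      M * (2 + 2 * ((n : ℝ) - 1) * R) / R ^ 2 := by
    have : M * 2 / R ^ 2 + ((n : ℝ) - 1) * Real.tanh t * (M * (2 * (t - b)) / R ^ 2) =
      M * (2 + 2 * ((n : ℝ) - 1) * (Real.tanh t * (t - b))) / R ^ 2 := by ring
    rw [this]
    gcongr
  have hy_part : E₁ * ((1 - a) * ((1 - a - 1) * y ^ (1 - a - 1 - 1))) +
      E₂ * (β * ((β - 1) * y ^ (β - 2))) +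
      a * (E₁ * ((1 - a) * y ^ (1 - a - 1 - 1)) + E₂ * (β * y ^ (β - 2))) =
      -(E₂ * β ^ 2 * y ^ (β - 2)) := by
    have : a = 1 - 2 * β := by linarith
    generalize y ^ (1 - a - 1 - 1) = P
    generalize y ^ (β - 2) = Q
    rw [this]; ring
  linarith

/-- Boundary values close to a constant on a long interval force `u` to be close to that constant
above the centre of the interval. -/
theorem exists_abs_sub_le (hu : BRSolution n a F u) (ha : a ∈ Ioo (-1 : ℝ) 1) (hn : 1 ≤ n) (L : ℝ)
    {T ε : ℝ} (hT : 0 < T) (hε : 0 < ε) :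
    ∃ R > 0, ∃ δ > 0, ∀ b, (∀ t, |t - b| ≤ R → |u t 0 - L| ≤ δ) →
      ∀ y, 0 ≤ y → y ≤ T → |u b y - L| ≤ ε := by
  obtain ⟨M₀, hM₀⟩ := hu.bounded
  set M := M₀ + |L| with hMdef
  have hM : ∀ t y, 0 ≤ y → |u t y - L| ≤ M := fun t y hy =>
    (abs_sub _ _).trans (add_le_add_left (hM₀ t y hy) _)
  set β := (1 - a) / 2 with hβ
  have hβ0 : 0 < β := by linarith [ha.2]
  have hT1 : 0 < T ^ (1 - a) := Real.rpow_pos_of_pos hT _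
  have hT2 : 0 < T ^ β := Real.rpow_pos_of_pos hT _
  set E₁ := ε / 3 / T ^ (1 - a) with hE₁
  set E₂ := ε / 3 / T ^ β with hE₂
  have hE₁0 : 0 < E₁ := by positivity
  have hE₂0 : 0 < E₂ := by positivity
  obtain ⟨H, hHT, hHM⟩ := ((eventually_ge_atTop T).and
    (((tendsto_rpow_atTop (show 0 < 1 - a by linarith [ha.2])).const_mul_atTop hE₁0).eventually_ge_atTop
      M)).exists
  have hH : 0 < H := hT.trans_le hHT
  have hrhs : 0 < E₂ * β ^ 2 * H ^ (β - 2) :=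
    mul_pos (by positivity) (Real.rpow_pos_of_pos hH _)
  have hlim : Tendsto (fun R : ℝ => M * 2 * R⁻¹ ^ 2 + M * 2 * ((n : ℝ) - 1) * R⁻¹) atTop (𝓝 0) := by
    have h := tendsto_inv_atTop_zero (𝕜 := ℝ)
    simpa using ((h.pow 2).const_mul (M * 2)).add (h.const_mul (M * 2 * ((n : ℝ) - 1)))
  obtain ⟨R, hR, hRM⟩ := ((eventually_gt_atTop (0 : ℝ)).and (hlim.eventually_lt_const hrhs)).exists
  refine ⟨R, hR, ε / 3, by positivity, fun b hb y hy hyT => ?_⟩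
  have hRM' : M * (2 + 2 * ((n : ℝ) - 1) * R) / R ^ 2 < E₂ * β ^ 2 * H ^ (β - 2) := by
    have : M * (2 + 2 * ((n : ℝ) - 1) * R) / R ^ 2 =
        M * 2 * R⁻¹ ^ 2 + M * 2 * ((n : ℝ) - 1) * R⁻¹ := by
      field_simp
    rwa [this]
  have h1 : E₁ * y ^ (1 - a) ≤ ε / 3 := by
    rw [hE₁, div_mul_eq_mul_div, div_le_iff₀ hT1]
    exact mul_le_mul_of_nonneg_left (Real.rpow_le_rpow hy hyT (by linarith [ha.2])) (by positivity)
  have h2 : E₂ * y ^ β ≤ ε / 3 := by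
    rw [hE₂, div_mul_eq_mul_div, div_le_iff₀ hT2]
    exact mul_le_mul_of_nonneg_left (Real.rpow_le_rpow hy hyT hβ0.le) (by positivity)
  have h3 := hu.mul_sub_le_barrier ha hn (σ := 1) (by simp) hM (by positivity) hE₁0.le hE₂0.le hR
    hβ hH hHM hRM' hb hy (hyT.trans hHT)
  have h4 := hu.mul_sub_le_barrier ha hn (σ := -1) (by simp) hM (by positivity) hE₁0.le hE₂0.le hR
    hβ hH hHM hRM' hb hy (hyT.trans hHT)
  rw [abs_le]
  constructor <;> linarith

theorem continuousOn_symmDiff (hu : BRSolution n a F u) {S : Set (ℝ × ℝ × ℝ)}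
    (hS : ∀ p ∈ S, 0 ≤ p.2.2) :
    ContinuousOn (fun p : ℝ × ℝ × ℝ => u (p.1 + p.2.1) p.2.2 - u (p.1 - p.2.1) p.2.2) S :=
  (hu.cont.comp (f := fun p : ℝ × ℝ × ℝ => (p.1 + p.2.1, p.2.2)) (by fun_prop)
    fun p hp => hS p hp).sub
  (hu.cont.comp (f := fun p : ℝ × ℝ × ℝ => (p.1 - p.2.1, p.2.2)) (by fun_prop)
    fun p hp => hS p hp)

/-- Bounds on small symmetric differences control the tangential derivative. -/
theorem abs_pt_le_of_symmDiff (hu : BRSolution n a F u) {b y C : ℝ} (hy : 0 < y) (hC : 0 ≤ C)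
    (h : ∀ σ : ℝ, |σ| = 1 → ∀ s, 0 ≤ s → s ≤ 1 → σ * (u (b + s) y - u (b - s) y) ≤ C * s) :
    |pt u b y| ≤ C := by
  have hpos : ∀ s, 0 ≤ s → s ≤ 1 → |u (b + s) y - u (b - s) y| ≤ C * s := fun s h0 h1 =>
    abs_le.mpr ⟨by linarith [h (-1) (by simp) s h0 h1], by linarith [h 1 (by simp) s h0 h1]⟩
  have hd : HasDerivAt (fun s => u (b + s) y - u (b - s) y) (2 * pt u b y) 0 := by
    have h1 : HasDerivAt (fun r => u r y) (pt u b y) (b + 0) := by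
      rw [add_zero]; exact hu.hasDerivAt_pt b hy
    have h2 : HasDerivAt (fun r => u r y) (pt u b y) (b - 0) := by
      rw [sub_zero]; exact hu.hasDerivAt_pt b hy
    refine ((h1.comp_const_add b 0).sub (h2.comp_const_sub b 0)).congr_deriv ?_
    ring
  have := hd.le_of_lip' hC (by
    filter_upwards [Icc_mem_nhds (show (-1 : ℝ) < 0 by norm_num) (show (0 : ℝ) < 1 by norm_num)]
      with s hs
    simp only [add_zero, sub_zero, sub_self, Real.norm_eq_abs]
    rcases le_total 0 s with h0 | h0
    · rw [abs_of_nonneg h0]; exact hpos s h0 hs.2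
    · have := hpos (-s) (by linarith) (by linarith [hs.1])
      rw [abs_sub_comm, abs_of_nonpos h0]
      simpa [sub_eq_add_neg] using this)
  rw [Real.norm_eq_abs, abs_mul, abs_two] at this
  linarith [abs_nonneg (pt u b y)]

theorem mul_symmDiff_le {σ L η x y : ℝ} (hσ : |σ| = 1) (hx : |x - L| ≤ η) (hy : |y - L| ≤ η) :
    σ * (x - y) ≤ 2 * η := by
  refine (le_abs_self _).trans ?_
  rw [abs_mul, hσ, one_mul]
  have := abs_sub_le x L y
  rw [abs_sub_comm L y] at this
  linarith

/-- Interior estimate for symmetric differences. -/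
theorem symmDiff_le_interior (hu : BRSolution n a F u) (ha : a ∈ Ioo (-1 : ℝ) 1) (hn : 1 ≤ n)
    {σ L η b ρ y₀ D : ℝ} (hσ : |σ| = 1) (hη : 0 < η) (hρ : 0 < ρ) (hy₀ : 2 * ρ ≤ y₀)
    (hD : 1 + 2 * ((n : ℝ) - 1) < D) (hDρ : 4 / ρ ^ 2 ≤ D)
    (hb : ∀ t y, |t - b| ≤ 2 → |y - y₀| ≤ ρ → |u t y - L| ≤ η) {s₀ : ℝ} (hs₀ : 0 ≤ s₀)
    (hs₀' : s₀ ≤ 1) :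
    σ * (u (b + s₀) y₀ - u (b - s₀) y₀) ≤ 2 * η * expBarrier ((n : ℝ) - 1) D s₀ := by
  have hc : (0 : ℝ) ≤ (n : ℝ) - 1 := by
    have : (1 : ℝ) ≤ n := by exact_mod_cast hn
    linarith
  set c := (n : ℝ) - 1 with hcdef
  set A := 2 * η with hA
  have hA0 : 0 < A := by positivity
  let Φ : ℝ → ℝ → ℝ → ℝ := fun t s y =>
    A * ((t - b) ^ 2 + expBarrier c D s + (y - y₀) ^ 2 / ρ ^ 2)
  by_contra! hcon
  let K : Set (ℝ × ℝ × ℝ) := Icc (b - 1) (b + 1) ×ˢ Icc 0 1 ×ˢ Icc (y₀ - ρ) (y₀ + ρ)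
  have hK : IsCompact K := isCompact_Icc.prod (isCompact_Icc.prod isCompact_Icc)
  have hcont : ContinuousOn (fun p : ℝ × ℝ × ℝ =>
      σ * (u (p.1 + p.2.1) p.2.2 - u (p.1 - p.2.1) p.2.2) - Φ p.1 p.2.1 p.2.2) K := by
    refine (continuousOn_const.mul (hu.continuousOn_symmDiff fun p hp => ?_)).sub
      (Continuous.continuousOn ?_)
    · linarith [hp.2.2.1]
    · have := continuous_expBarrier c D
      fun_prop
  have hbK : (b, s₀, y₀) ∈ K :=
    ⟨⟨by simp, by simp⟩, ⟨hs₀, hs₀'⟩, by simp [hρ.le], by simp [hρ.le]⟩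
  obtain ⟨⟨t, s, y⟩, ⟨⟨ht1, ht2⟩, ⟨hs1, hs2⟩, hy1, hy2⟩, hmax⟩ :=
    hK.exists_isMaxOn ⟨_, hbK⟩ hcont
  simp only at ht1 ht2 hs1 hs2 hy1 hy2
  have hpos : Φ t s y < σ * (u (t + s) y - u (t - s) y) := by
    have h1 : σ * (u (b + s₀) y₀ - u (b - s₀) y₀) - Φ b s₀ y₀ ≤
      σ * (u (t + s) y - u (t - s) y) - Φ t s y := hmax hbK
    have h2 : Φ b s₀ y₀ = A * expBarrier c D s₀ := by simp [Φ]
    linarith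
  have hDpos : 1 ≤ D := by linarith
  have hp1 : 0 ≤ (t - b) ^ 2 := sq_nonneg _
  have hp2 : s ≤ expBarrier c D s := self_le_expBarrier hc hDpos hs1 hs2
  have hp3 : 0 ≤ (y - y₀) ^ 2 / ρ ^ 2 := by positivity
  have hpA : ∀ x, 1 ≤ x → A ≤ A * x := fun x hx => le_mul_of_one_le_right hA0.le hx
  have htb : |t - b| ≤ 1 := abs_le.mpr ⟨by linarith, by linarith⟩
  have hyb : |y - y₀| ≤ ρ := abs_le.mpr ⟨by linarith, by linarith⟩
  have hw : σ * (u (t + s) y - u (t - s) y) ≤ A :=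
    mul_symmDiff_le hσ (hb _ _ (abs_le.mpr ⟨by linarith, by linarith⟩) hyb)
      (hb _ _ (abs_le.mpr ⟨by linarith, by linarith⟩) hyb)
  have hlt : (t - b) ^ 2 + expBarrier c D s + (y - y₀) ^ 2 / ρ ^ 2 < 1 := by
    by_contra! h
    exact absurd (hpos.trans_le hw) (not_lt.mpr (hpA _ h))
  have htb' : |t - b| < 1 := by
    refine lt_of_le_of_ne htb fun h => ?_
    have : (t - b) ^ 2 = 1 := by rw [← sq_abs, h, one_pow]
    linarith
  have hyb' : |y - y₀| < ρ := by
    refine lt_of_le_of_ne hyb fun h => ?_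
    have : (y - y₀) ^ 2 / ρ ^ 2 = 1 := by rw [← sq_abs, h]; field_simp
    linarith
  have hs1' : s < 1 := by linarith
  have hs0 : 0 < s := by
    refine lt_of_le_of_ne hs1 fun h => ?_
    subst h
    have h1 : σ * (u (t + 0) y - u (t - 0) y) = 0 := by simp
    have h2 : 0 ≤ Φ t 0 y := mul_nonneg hA0.le (by linarith)
    linarith
  obtain ⟨ht3, ht4⟩ := abs_lt.mp htb'
  obtain ⟨hy3, hy4⟩ := abs_lt.mp hyb'
  have hy0 : 0 < y := by linarith
  have mt : IsLocalMax (fun r => σ * (u (r + s) y - u (r - s) y) - Φ r s y) t := by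
    filter_upwards [Icc_mem_nhds (show b - 1 < t by linarith) (show t < b + 1 by linarith)] with r hr
    exact hmax (show (r, s, y) ∈ K from ⟨hr, ⟨hs1, hs2⟩, hy1, hy2⟩)
  have ms : IsLocalMax (fun r => σ * (u (t + r) y - u (t - r) y) - Φ t r y) s := by
    filter_upwards [Icc_mem_nhds hs0 hs1'] with r hr
    exact hmax (show (t, r, y) ∈ K from ⟨⟨ht1, ht2⟩, hr, hy1, hy2⟩)
  have my : IsLocalMax (fun z => σ * (u (t + s) z - u (t - s) z) - Φ t s z) y := by
    filter_upwards [Icc_mem_nhds (show y₀ - ρ < y by linarith) (show y < y₀ + ρ by linarith)]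
      with z hz
    exact hmax (show (t, s, z) ∈ K from ⟨⟨ht1, ht2⟩, ⟨hs1, hs2⟩, hz⟩)
  obtain ⟨β, γ, hβ, hγ, key⟩ := hu.touch_symmDiff σ hy0 mt ms my
    (ft' := fun r => A * (2 * (r - b))) (ft2 := A * 2)
    (fs' := fun r => A * expBarrier' c D r) (fs2 := A * -((2 * c + 2) * expBarrier' c D s))
    (fy' := fun z => A * (2 * (z - y₀) / ρ ^ 2)) (fy2 := A * (2 / ρ ^ 2))
    (fun r => by
      have := (((((hasDerivAt_id r).sub_const b).pow 2).add_const (expBarrier c D s)).add_const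
        ((y - y₀) ^ 2 / ρ ^ 2)).const_mul A
      exact this.congr_deriv (by simp))
    ((((hasDerivAt_id t).sub_const b).const_mul 2).const_mul A |>.congr_deriv (by simp))
    (fun r => (((hasDerivAt_expBarrier c D r).const_add ((t - b) ^ 2)).add_const
      ((y - y₀) ^ 2 / ρ ^ 2)).const_mul A)
    ((hasDerivAt_expBarrier' c D s).const_mul A)
    (fun z _ => by
      have := (((((hasDerivAt_id z).sub_const y₀).pow 2).div_const (ρ ^ 2)).const_add
        ((t - b) ^ 2 + expBarrier c D s)).const_mul A
      exact this.congr_deriv (by simp))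
    (((((hasDerivAt_id y).sub_const y₀).const_mul 2).div_const (ρ ^ 2)).const_mul A
      |>.congr_deriv (by simp))
  have hstrict := expBarrier_strict hc hD hs2 hβ hγ htb
  have hya : a / y * (y - y₀) ≤ 1 := by
    refine (le_abs_self _).trans ?_
    rw [div_mul_eq_mul_div, abs_div, abs_mul, abs_of_pos hy0, div_le_one hy0]
    have : |a| ≤ 1 := abs_le.mpr ⟨ha.1.le, ha.2.le⟩
    nlinarith [abs_nonneg (y - y₀)]
  have hρ2 : 0 < 2 / ρ ^ 2 := by positivity
  have hypart : 2 / ρ ^ 2 + a / y * (2 * (y - y₀) / ρ ^ 2) ≤ D := by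
    have h1 : 2 / ρ ^ 2 + a / y * (2 * (y - y₀) / ρ ^ 2) =
      2 / ρ ^ 2 * (1 + a / y * (y - y₀)) := by ring
    have h2 : 2 / ρ ^ 2 * (1 + a / y * (y - y₀)) ≤ 2 / ρ ^ 2 * 2 :=
      mul_le_mul_of_nonneg_left (by linarith) hρ2.le
    have h3 : 2 / ρ ^ 2 * 2 = 4 / ρ ^ 2 := by ring
    linarith
  have hprod : 0 ≤ A * ((2 / ρ ^ 2 + a / y * (2 * (y - y₀) / ρ ^ 2)) +
      (2 + -((2 * c + 2) * expBarrier' c D s)) / 2 +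
      c * (β * expBarrier' c D s + γ * (2 * (t - b)))) := by linarith
  have := nonneg_of_mul_nonneg_right hprod hA0
  linarith

/-- Estimate for symmetric differences up to the boundary, in terms of the oscillation of `u` and
of the tangential derivative at the top of the box. -/
theorem symmDiff_le_boundary (hu : BRSolution n a F u) (ha : a ∈ Ioo (-1 : ℝ) 1) (hn : 1 ≤ n)
    {σ L η G b h κ Λ D : ℝ} (hσ : |σ| = 1) (hη : 0 < η) (hG : 0 ≤ G) (hh : 0 < h) (hκ : 0 ≤ κ)
    (hκh : κ * h ^ (1 - a) ≤ 1 / 2) (hΛκ : Λ < κ * (1 - a))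
    (hΛ : ∀ t t', |deriv F (u t 0) - deriv F (u t' 0)| ≤ Λ * |u t 0 - u t' 0|)
    (hD : 1 + 2 * ((n : ℝ) - 1) < D)
    (hb : ∀ t y, |t - b| ≤ 2 → 0 ≤ y → y ≤ h → |u t y - L| ≤ η)
    (hbG : ∀ t, |t - b| ≤ 2 → |pt u t h| ≤ G) {s₀ y₀ : ℝ} (hs₀ : 0 ≤ s₀) (hs₀' : s₀ ≤ 1)
    (hy₀ : 0 ≤ y₀) (hy₀' : y₀ ≤ h) :
    σ * (u (b + s₀) y₀ - u (b - s₀) y₀) ≤ 4 * (η + G) * expBarrier ((n : ℝ) - 1) D s₀ := by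
  have hc : (0 : ℝ) ≤ (n : ℝ) - 1 := by
    have : (1 : ℝ) ≤ n := by exact_mod_cast hn
    linarith
  have ha1 : 0 < 1 - a := by linarith [ha.2]
  set c := (n : ℝ) - 1 with hcdef
  set A := 4 * (η + G) with hA
  have hA0 : 0 < A := by positivity
  have hDpos : 1 ≤ D := by linarith
  let g : ℝ → ℝ := fun y => 1 - κ * y ^ (1 - a)
  have hgc : Continuous g := by
    have : Continuous fun y : ℝ => y ^ (1 - a) := continuous_id.rpow_const fun _ => Or.inr ha1.le
    fun_prop
  have hg : ∀ y, 0 ≤ y → y ≤ h → 1 / 2 ≤ g y := fun y h0 h1 => by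
    have : κ * y ^ (1 - a) ≤ κ * h ^ (1 - a) :=
      mul_le_mul_of_nonneg_left (Real.rpow_le_rpow h0 h1 ha1.le) hκ
    simp only [g]; linarith
  have hg1 : ∀ y, 0 ≤ y → g y ≤ 1 := fun y h0 => by
    have : 0 ≤ κ * y ^ (1 - a) := mul_nonneg hκ (Real.rpow_nonneg h0 _)
    simp only [g]; linarith
  let p : ℝ → ℝ → ℝ := fun t s => (t - b) ^ 2 + expBarrier c D s
  by_contra! hcon
  let K : Set (ℝ × ℝ × ℝ) := Icc (b - 1) (b + 1) ×ˢ Icc 0 1 ×ˢ Icc 0 h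
  have hK : IsCompact K := isCompact_Icc.prod (isCompact_Icc.prod isCompact_Icc)
  have hcont : ContinuousOn (fun q : ℝ × ℝ × ℝ =>
      σ * (u (q.1 + q.2.1) q.2.2 - u (q.1 - q.2.1) q.2.2) / g q.2.2 - A * p q.1 q.2.1) K := by
    refine ((continuousOn_const.mul (hu.continuousOn_symmDiff fun q hq => hq.2.2.1)).div
      (Continuous.continuousOn (by fun_prop)) fun q hq => ?_).sub (Continuous.continuousOn ?_)
    · linarith [hg _ hq.2.2.1 hq.2.2.2]
    · have := continuous_expBarrier c D
      fun_prop
  have hbK : (b, s₀, y₀) ∈ K := ⟨⟨by simp, by simp⟩, ⟨hs₀, hs₀'⟩, hy₀, hy₀'⟩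
  obtain ⟨⟨t, s, y⟩, ⟨⟨ht1, ht2⟩, ⟨hs1, hs2⟩, hy1, hy2⟩, hmax⟩ :=
    hK.exists_isMaxOn ⟨_, hbK⟩ hcont
  simp only at ht1 ht2 hs1 hs2 hy1 hy2
  set m := σ * (u (t + s) y - u (t - s) y) / g y - A * p t s with hm
  have hgy := hg y hy1 hy2
  have hm0 : 0 < m := by
    have h1 : σ * (u (b + s₀) y₀ - u (b - s₀) y₀) / g y₀ - A * p b s₀ ≤ m := hmax hbK
    have h2 : p b s₀ = expBarrier c D s₀ := by simp [p]
    have h3 := hg y₀ hy₀ hy₀'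
    have h4 : A * expBarrier c D s₀ < σ * (u (b + s₀) y₀ - u (b - s₀) y₀) / g y₀ := by
      rw [lt_div_iff₀ (by linarith)]
      refine lt_of_le_of_lt (mul_le_of_le_one_right ?_ (hg1 y₀ hy₀)) hcon
      exact mul_nonneg hA0.le (hs₀.trans (self_le_expBarrier hc hDpos hs₀ hs₀'))
    rw [h2] at h1
    linarith
  have hweq : σ * (u (t + s) y - u (t - s) y) = g y * (A * p t s + m) := by
    have : g y ≠ 0 := by linarith
    rw [hm]; field_simp; ring
  have hwle : ∀ q ∈ K, σ * (u (q.1 + q.2.1) q.2.2 - u (q.1 - q.2.1) q.2.2) ≤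
      g q.2.2 * (A * p q.1 q.2.1 + m) := fun q hq => by
    have h1 : σ * (u (q.1 + q.2.1) q.2.2 - u (q.1 - q.2.1) q.2.2) / g q.2.2 - A * p q.1 q.2.1 ≤ m :=
      hmax hq
    have h2 := hg _ hq.2.2.1 hq.2.2.2
    rw [sub_le_iff_le_add, div_le_iff₀ (by linarith)] at h1
    linarith
  have hp1 : 0 ≤ (t - b) ^ 2 := sq_nonneg _
  have hp2 : s ≤ expBarrier c D s := self_le_expBarrier hc hDpos hs1 hs2
  have htb : |t - b| ≤ 1 := abs_le.mpr ⟨by linarith, by linarith⟩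
  have hpnn : 0 ≤ p t s := by simp only [p]; linarith
  have hAp : 1 / 2 * (A * p t s) < σ * (u (t + s) y - u (t - s) y) := by
    rw [hweq]
    have : 0 ≤ A * p t s := mul_nonneg hA0.le hpnn
    nlinarith
  have hw : σ * (u (t + s) y - u (t - s) y) ≤ 2 * η :=
    mul_symmDiff_le hσ (hb _ _ (abs_le.mpr ⟨by linarith, by linarith⟩) hy1 hy2)
      (hb _ _ (abs_le.mpr ⟨by linarith, by linarith⟩) hy1 hy2)
  have hlt : (t - b) ^ 2 + expBarrier c D s < 1 := by
    by_contra! h1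
    have : A * 1 ≤ A * p t s := mul_le_mul_of_nonneg_left h1 hA0.le
    linarith
  have htb' : |t - b| < 1 := by
    refine lt_of_le_of_ne htb fun h => ?_
    have : (t - b) ^ 2 = 1 := by rw [← sq_abs, h, one_pow]
    linarith
  have hs1' : s < 1 := by linarith
  have hs0 : 0 < s := by
    refine lt_of_le_of_ne hs1 fun h => ?_
    subst h
    have h1 : σ * (u (t + 0) y - u (t - 0) y) = 0 := by simp
    have h2 : 0 ≤ A * p t 0 := mul_nonneg hA0.le hpnn
    linarith
  obtain ⟨ht3, ht4⟩ := abs_lt.mp htb'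
  have hyh : y < h := by
    refine lt_of_le_of_ne hy2 fun hyh => ?_
    subst hyh
    have h1 : |u (t + s) y - u (t - s) y| ≤ G * |t + s - (t - s)| :=
      (convex_Icc (b - 2) (b + 2)).norm_image_sub_le_of_norm_hasDerivWithin_le
        (f := fun r => u r y) (f' := fun r => pt u r y)
        (fun r _ => (hu.hasDerivAt_pt r hh).hasDerivWithinAt)
        (fun r hr => hbG r (abs_le.mpr ⟨by linarith [hr.1], by linarith [hr.2]⟩))
        ⟨by linarith, by linarith⟩ ⟨by linarith, by linarith⟩
    have h2 : |t + s - (t - s)| = 2 * s := by rw [abs_of_nonneg] <;> linarith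
    have h3 : σ * (u (t + s) y - u (t - s) y) ≤ |u (t + s) y - u (t - s) y| := by
      refine (le_abs_self _).trans ?_
      rw [abs_mul, hσ, one_mul]
    have h4 : A * s ≤ A * p t s :=
      mul_le_mul_of_nonneg_left (by simp only [p]; linarith) hA0.le
    rw [h2] at h1
    have h5 : 0 < η * s := mul_pos hη hs0
    nlinarith
  have hg' : ∀ z, 0 < z → HasDerivAt g (-(κ * ((1 - a) * z ^ (1 - a - 1)))) z := fun z hz =>
    ((Real.hasDerivAt_rpow_const (p := 1 - a) (Or.inl hz.ne')).const_mul κ).const_sub 1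
  have hmy : ∀ z ∈ Icc 0 h, σ * (u (t + s) z - u (t - s) z) - g z * (A * p t s + m) ≤
      σ * (u (t + s) y - u (t - s) y) - g y * (A * p t s + m) := fun z hz => by
    rw [← hweq, sub_self]
    exact sub_nonpos.mpr (hwle (t, s, z) ⟨⟨ht1, ht2⟩, ⟨hs1, hs2⟩, hz⟩)
  have hy0 : 0 < y := by
    refine lt_of_le_of_ne hy1 fun hy => ?_
    subst hy
    have hg0 : g 0 = 1 := by simp [g, Real.zero_rpow ha1.ne']
    rw [hg0, one_mul] at hweq
    have hwpos : 0 < σ * (u (t + s) 0 - u (t - s) 0) := by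
      rw [hweq]; exact add_pos_of_nonneg_of_pos (mul_nonneg hA0.le hpnn) hm0
    refine not_forall_le_of_tendsto_rpow_mul_deriv
      (f := fun z => σ * (u (t + s) z - u (t - s) z) - g z * (A * p t s + m))
      (f' := fun z => σ * (py u (t + s) z - py u (t - s) z) -
        -(κ * ((1 - a) * z ^ (1 - a - 1))) * (A * p t s + m))
      (a := a) (l := σ * (deriv F (u (t + s) 0) - deriv F (u (t - s) 0)) +
        κ * (1 - a) * (A * p t s + m)) hh ?_ ?_ ?_ ?_ hmy
    · have hline : ∀ r, ContinuousOn (fun z => u r z) (Icc 0 h) := fun r =>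
        hu.cont.comp (f := fun z : ℝ => (r, z)) (by fun_prop) fun z hz => hz.1
      exact (continuousOn_const.mul ((hline _).sub (hline _))).sub
        (hgc.mul continuous_const).continuousOn
    · intro z hz
      exact (((hu.hasDerivAt_py _ hz).sub (hu.hasDerivAt_py _ hz)).const_mul σ).sub
        ((hg' z hz).mul_const _)
    · refine ((((hu.bc (t + s)).sub (hu.bc (t - s))).const_mul σ).add_const
        (κ * (1 - a) * (A * p t s + m))).congr' ?_
      filter_upwards [self_mem_nhdsWithin] with z hz
      have : z ^ a * z ^ (1 - a - 1) = 1 := by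
        rw [← Real.rpow_add hz]; simp
      linear_combination (-(κ * (1 - a) * (A * p t s + m))) * this
    · rw [← hweq]
      have h1 : |σ * (deriv F (u (t + s) 0) - deriv F (u (t - s) 0))| ≤
          Λ * (σ * (u (t + s) 0 - u (t - s) 0)) := by
        rw [abs_mul, hσ, one_mul, ← abs_of_pos hwpos, abs_mul, hσ, one_mul]
        exact hΛ _ _
      have h2 := neg_le_of_abs_le h1
      have h3 := mul_lt_mul_of_pos_right hΛκ hwpos
      linarith
  have mt : IsLocalMax (fun r => σ * (u (r + s) y - u (r - s) y) - g y * (A * p r s + m)) t := by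
    filter_upwards [Icc_mem_nhds (show b - 1 < t by linarith) (show t < b + 1 by linarith)] with r hr
    rw [← hweq, sub_self]
    exact sub_nonpos.mpr (hwle (r, s, y) ⟨hr, ⟨hs1, hs2⟩, hy1, hy2⟩)
  have ms : IsLocalMax (fun r => σ * (u (t + r) y - u (t - r) y) - g y * (A * p t r + m)) s := by
    filter_upwards [Icc_mem_nhds hs0 hs1'] with r hr
    rw [← hweq, sub_self]
    exact sub_nonpos.mpr (hwle (t, r, y) ⟨⟨ht1, ht2⟩, hr, hy1, hy2⟩)
  have my : IsLocalMax (fun z => σ * (u (t + s) z - u (t - s) z) - g z * (A * p t s + m)) y := by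
    filter_upwards [Icc_mem_nhds hy0 hyh] with z hz using hmy z hz
  obtain ⟨β, γ, hβ, hγ, key⟩ := hu.touch_symmDiff σ hy0 mt ms my
    (ft' := fun r => g y * (A * (2 * (r - b)))) (ft2 := g y * (A * 2))
    (fs' := fun r => g y * (A * expBarrier' c D r))
    (fs2 := g y * (A * -((2 * c + 2) * expBarrier' c D s)))
    (fy' := fun z => -(κ * ((1 - a) * z ^ (1 - a - 1))) * (A * p t s + m))
    (fy2 := -(κ * ((1 - a) * ((1 - a - 1) * y ^ (1 - a - 1 - 1)))) * (A * p t s + m))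
    (fun r => by
      have := ((((((hasDerivAt_id r).sub_const b).pow 2).add_const
        (expBarrier c D s)).const_mul A).add_const m).const_mul (g y)
      exact this.congr_deriv (by simp))
    (((((hasDerivAt_id t).sub_const b).const_mul 2).const_mul A).const_mul (g y)
      |>.congr_deriv (by simp))
    (fun r => ((((hasDerivAt_expBarrier c D r).const_add ((t - b) ^ 2)).const_mul A).add_const
      m).const_mul (g y))
    (((hasDerivAt_expBarrier' c D s).const_mul A).const_mul (g y))
    (fun z hz => (hg' z hz).mul_const _)
    (((((Real.hasDerivAt_rpow_const (Or.inl hy0.ne')).const_mul _).const_mul κ).neg).mul_const _)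
  have hstrict := expBarrier_strict hc hD hs2 hβ hγ htb
  have hP : y ^ (1 - a - 1) = y ^ (1 - a - 1 - 1) * y := by
    rw [← Real.rpow_add_one hy0.ne']; ring_nf
  have hypart : -(κ * ((1 - a) * ((1 - a - 1) * y ^ (1 - a - 1 - 1)))) * (A * p t s + m) +
      a / y * (-(κ * ((1 - a) * y ^ (1 - a - 1))) * (A * p t s + m)) = 0 := by
    rw [hP]; field_simp; ring
  simp only [hypart] at key
  have hprod : 0 ≤ (g y * A) * ((2 + -((2 * c + 2) * expBarrier' c D s)) / 2 +
      c * (β * expBarrier' c D s + γ * (2 * (t - b)))) := by linarith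
  have := nonneg_of_mul_nonneg_right hprod (mul_pos (by linarith) hA0)
  linarith

/-- Gradient estimate at a fixed distance from the boundary. -/
theorem exists_abs_pt_le_interior (hu : BRSolution n a F u) (ha : a ∈ Ioo (-1 : ℝ) 1) (hn : 1 ≤ n)
    {ρ : ℝ} (hρ : 0 < ρ) :
    ∃ C > 0, ∀ L η b y₀, 0 < η → 2 * ρ ≤ y₀ →
      (∀ t y, |t - b| ≤ 2 → |y - y₀| ≤ ρ → |u t y - L| ≤ η) → |pt u b y₀| ≤ C * η := by
  have hc : (1 : ℝ) ≤ n := by exact_mod_cast hn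
  set c := (n : ℝ) - 1 with hcdef
  have hc0 : 0 ≤ c := by linarith
  set D := 2 + 2 * c + 4 / ρ ^ 2 with hD
  have hρ2 : 0 < 4 / ρ ^ 2 := by positivity
  refine ⟨2 * (exp (2 * c + 2) * D * (2 * c + 2)), by positivity, fun L η b y₀ hη hy₀ hb => ?_⟩
  refine hu.abs_pt_le_of_symmDiff (by linarith) (by positivity) fun σ hσ s hs0 hs1 => ?_
  refine (hu.symmDiff_le_interior ha hn hσ hη hρ hy₀ (D := D) (by linarith) (by linarith) hb
    hs0 hs1).trans ?_
  have := mul_le_mul_of_nonneg_left (expBarrier_le (c := c) (D := D) (s := s) (by positivity))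
    (show 0 ≤ 2 * η by positivity)
  linarith

/-- Gradient estimate up to the boundary. -/
theorem exists_abs_pt_le_boundary (hu : BRSolution n a F u) (ha : a ∈ Ioo (-1 : ℝ) 1) (hn : 1 ≤ n)
    (hF : ContDiff ℝ 2 F) :
    ∃ h > 0, ∃ C > 0, ∀ L η G b, 0 < η → 0 ≤ G →
      (∀ t y, |t - b| ≤ 2 → 0 ≤ y → y ≤ h → |u t y - L| ≤ η) →
      (∀ t, |t - b| ≤ 2 → |pt u t h| ≤ G) →
      ∀ y, 0 < y → y ≤ h → |pt u b y| ≤ C * (η + G) := by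
  obtain ⟨M, hM⟩ := hu.bounded
  have hF' : ContDiff ℝ 1 (deriv F) := ContDiff.deriv' (by rw [one_add_one_eq_two]; exact hF)
  obtain ⟨Λ, hΛ⟩ := hF'.contDiffOn.exists_lipschitzOnWith one_ne_zero
    (convex_Icc (-M) M) isCompact_Icc
  have ha1 : 0 < 1 - a := by linarith [ha.2]
  set κ : ℝ := (Λ + 1) / (1 - a) with hκ
  have hκ0 : 0 < κ := by positivity
  have hc : (1 : ℝ) ≤ n := by exact_mod_cast hn
  set c := (n : ℝ) - 1 with hcdef
  have hc0 : 0 ≤ c := by linarith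
  set D := 2 + 2 * c with hD
  refine ⟨(1 / (2 * κ)) ^ (1 - a)⁻¹, by positivity,
    4 * (exp (2 * c + 2) * D * (2 * c + 2)), by positivity, fun L η G b hη hG hb hbG y hy hyh => ?_⟩
  refine hu.abs_pt_le_of_symmDiff hy (by positivity) fun σ hσ s hs0 hs1 => ?_
  refine (hu.symmDiff_le_boundary ha hn hσ hη hG (by positivity) hκ0.le (D := D) (Λ := Λ) ?_ ?_ ?_
    (by linarith) hb hbG hs0 hs1 hy.le hyh).trans ?_
  · rw [Real.rpow_inv_rpow (by positivity) ha1.ne']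
    field_simp; rfl
  · rw [hκ, div_mul_cancel₀ _ ha1.ne']; linarith
  · intro t t'
    simpa [Real.dist_eq] using
      hΛ.dist_le_mul _ (abs_le.mp (hM t 0 le_rfl)) _ (abs_le.mp (hM t' 0 le_rfl))
  · have := mul_le_mul_of_nonneg_left (expBarrier_le (c := c) (D := D) (s := s) (by positivity))
      (show 0 ≤ 4 * (η + G) by positivity)
    linarith

/-- If the trace of `u` is close to a constant on a long interval, then the tangential derivative
is small above the centre of the interval. -/
theorem exists_abs_pt_lt (hu : BRSolution n a F u) (ha : a ∈ Ioo (-1 : ℝ) 1) (hn : 1 ≤ n)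
    (hF : ContDiff ℝ 2 F) (L : ℝ) {T ε : ℝ} (hT : 0 < T) (hε : 0 < ε) :
    ∃ R > 0, ∃ δ > 0, ∀ b, (∀ t, |t - b| ≤ R → |u t 0 - L| ≤ δ) →
      ∀ y, 0 ≤ y → y ≤ T → |pt u b y| < ε := by
  obtain ⟨h, hh, C₁, hC₁, hbdry⟩ := hu.exists_abs_pt_le_boundary ha hn hF
  obtain ⟨C₂, hC₂, hint⟩ := hu.exists_abs_pt_le_interior ha hn (half_pos hh)
  set C := C₁ * (1 + C₂) + C₂ with hC
  have hC0 : 0 < C := by positivity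
  set η := ε / (2 * C) with hη
  have hη0 : 0 < η := by positivity
  have hCη : C * η = ε / 2 := by rw [hη]; field_simp
  obtain ⟨R, hR, δ, hδ, hosc⟩ := hu.exists_abs_sub_le ha hn L
    (show 0 < T + 2 * h by positivity) hη0
  refine ⟨R + 4, by positivity, δ, hδ, fun b hb => ?_⟩
  have hnear : ∀ t y, |t - b| ≤ 4 → 0 ≤ y → y ≤ T + 2 * h → |u t y - L| ≤ η := fun t y ht =>
    hosc t (fun r hr => hb r (by linarith [abs_sub_le r t b])) y
  have hfar : ∀ t y, |t - b| ≤ 2 → h ≤ y → y ≤ T + h → |pt u t y| ≤ C₂ * η := by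
    intro t y ht hy hyT
    refine hint L η t y hη0 (by linarith) fun r z hr hz => ?_
    obtain ⟨hz1, hz2⟩ := abs_le.mp hz
    exact hnear r z (by linarith [abs_sub_le r t b]) (by linarith) (by linarith)
  have hpos : ∀ y, 0 < y → y ≤ T → |pt u b y| ≤ ε / 2 := by
    intro y hy hyT
    rw [← hCη]
    rcases le_total h y with hhy | hyh
    · refine (hfar b y (by simp) hhy (by linarith)).trans
        (mul_le_mul_of_nonneg_right ?_ hη0.le)
      rw [hC]
      have : 0 < C₁ * (1 + C₂) := by positivity
      linarith
    · have := hbdry L η (C₂ * η) b hη0 (by positivity)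
        (fun t y ht hy0 hy1 => hnear t y (by linarith) hy0 (by linarith))
        (fun t ht => hfar t h ht le_rfl (by linarith)) y hy hyh
      have h2 : 0 < C₂ * η := by positivity
      rw [hC]
      linarith
  intro y hy hyT
  rcases hy.eq_or_lt with rfl | hy
  · have hcont : ContinuousOn (fun z => pt u b z) (Ici 0) :=
      hu.pt_cont.comp (f := fun z : ℝ => (b, z)) (by fun_prop) fun z hz => hz
    have hlim : Tendsto (fun z => |pt u b z|) (𝓝[>] 0) (𝓝 |pt u b 0|) :=
      ((hcont 0 self_mem_Ici).mono_left (nhdsWithin_mono _ Ioi_subset_Ici_self)).abs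
    have : |pt u b 0| ≤ ε / 2 := le_of_tendsto hlim (by
      filter_upwards [Ioc_mem_nhdsGT hT] with z hz using hpos z hz.1 hz.2)
    linarith
  · linarith [hpos y hy hyT]

end BRSolution

/-- Gradient decay: if `u` is a classical solution of the boundary reaction problem with
`u(t,0) → L^±` as `t → ±∞`, then for every fixed `T > 0` the supremum of `|∂_t u|` over
the half-disc `{(s,y) : (s-b)² + y² ≤ T², y ≥ 0}` tends to `0` as `b → +∞` and as
`b → -∞`. -/
theorem stmt6 (n : ℕ) (hn : 2 ≤ n) (a : ℝ) (ha : a ∈ Set.Ioo (-1:ℝ) 1)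
    (F : ℝ → ℝ) (hF : DoubleWell F) (u : ℝ → ℝ → ℝ)
    (hu : BRSolution n a F u)
    (Lm Lp : ℝ)
    (hlp : Tendsto (fun t => u t 0) atTop (𝓝 Lp))
    (hlm : Tendsto (fun t => u t 0) atBot (𝓝 Lm)) :
    ∀ T : ℝ, 0 < T →
      (∀ ε : ℝ, 0 < ε → ∃ B : ℝ, ∀ b : ℝ, B ≤ b → ∀ s y : ℝ,
        (s - b) ^ 2 + y ^ 2 ≤ T ^ 2 → 0 ≤ y → |pt u s y| < ε) ∧
      (∀ ε : ℝ, 0 < ε → ∃ B : ℝ, ∀ b : ℝ, b ≤ B → ∀ s y : ℝ,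
        (s - b) ^ 2 + y ^ 2 ≤ T ^ 2 → 0 ≤ y → |pt u s y| < ε) := by
  intro T hT
  have hn1 : 1 ≤ n := by lia
  have hF2 : ContDiff ℝ 2 F := contDiff_infty.mp hF.1 2
  refine ⟨fun ε hε => ?_, fun ε hε => ?_⟩
  · obtain ⟨R, -, δ, hδ, h⟩ := hu.exists_abs_pt_lt ha hn1 hF2 Lp hT hε
    obtain ⟨B, hB⟩ := eventually_atTop.mp (Metric.tendsto_nhds.mp hlp δ hδ)
    refine ⟨B + R + T, fun b hb s y hsy hy => h s (fun t ht => ?_) y hy ?_⟩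
    · have h1 := (abs_le_of_sq_le_sq' (show (s - b) ^ 2 ≤ T ^ 2 by nlinarith) hT.le).1
      exact (hB t (by linarith [(abs_le.mp ht).1])).le
    · exact le_of_sq_le_sq (by nlinarith) hT.le
  · obtain ⟨R, -, δ, hδ, h⟩ := hu.exists_abs_pt_lt ha hn1 hF2 Lm hT hε
    obtain ⟨B, hB⟩ := eventually_atBot.mp (Metric.tendsto_nhds.mp hlm δ hδ)
    refine ⟨B - R - T, fun b hb s y hsy hy => h s (fun t ht => ?_) y hy ?_⟩
    · have h1 := (abs_le_of_sq_le_sq' (show (s - b) ^ 2 ≤ T ^ 2 by nlinarith) hT.le).2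
      exact (hB t (by linarith [(abs_le.mp ht).2])).le
    · exact le_of_sq_le_sq (by nlinarith) hT.le
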